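/- For every m ≥ 4, every k ≥ 5, and every even number a with 2 ≤ a ≤ 2⌈m/2⌉ - 2, the element β_{a,k} = v_a^{k-3}·α, where α = Σ_{j=1}^{m} (2m - 3j)·v_{2j}·w_{4m-(2j+1)}, is a cocycle of cohomological degree a(k-3) + 4m - 1 in ʳΩ_k^{*,*}(CP^m) that is not a coboundary; hence the cohomology group of ʳΩ_k^{*,*}(CP^m) in degree a(k-3) + 4m - 1 is nonzero. -/

import Mathlib

/-!
# The (reduced) Chevalley–Eilenberg complex for `ℂP^m`

We model the free graded-commutative algebra on generators
`v_0, v_2, …, v_{2m}` (even, polynomial; `v_{2i}` has degree `2i`, weight `0`, length `1`) and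
`w_{2m-1}, w_{2m+1}, …, w_{4m-1}` (odd, exterior; `w_{2m-1+2j}` has degree `2m-1+2j`,
weight `1`, length `2`) by its monomial basis: a monomial is a pair `(e, S)` where
`e : Fin (m+1) → ℕ` records the exponents of the `v`'s (`e i` is the exponent of `v_{2i}`) and
`S : Finset (Fin (m+1))` records the set of `w`'s occurring (`j ∈ S` means `w_{2m-1+2j}` occurs).
An element of the algebra is a finitely supported `ℚ`-linear combination of monomials.
The differential is the degree `+1` derivation with `∂ v_{2i} = 0` and
`∂ w_{2i-1} = ∑_{a+b=i, 0 ≤ a,b ≤ m} v_{2a} v_{2b}` (for `m ≤ i ≤ 2m`), with the usual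
Koszul signs.
-/

noncomputable section

/-- Monomials: exponents of the even generators `v_{2i}` and the set of odd generators
`w_{2m-1+2j}` occurring. -/
abbrev CEMon (m : ℕ) : Type := (Fin (m + 1) → ℕ) × Finset (Fin (m + 1))

/-- The underlying `ℚ`-vector space of the Chevalley–Eilenberg algebra for `ℂP^m`:
finitely supported linear combinations of monomials. -/
abbrev CEAlg (m : ℕ) : Type := CEMon m →₀ ℚ

/-- Cohomological degree of a monomial: `v_{2i}` has degree `2i` and `w_{2m-1+2j}` has
degree `2m - 1 + 2j`. -/
def CEdeg (m : ℕ) (b : CEMon m) : ℕ :=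
  (∑ i : Fin (m + 1), 2 * i.val * b.1 i) + ∑ j ∈ b.2, (2 * m + 2 * j.val - 1)

/-- Length of a monomial: each `v` has length `1`, each `w` has length `2`. -/
def CElen (m : ℕ) (b : CEMon m) : ℕ := (∑ i : Fin (m + 1), b.1 i) + 2 * b.2.card

/-- Weight of a monomial: each `v` has weight `0`, each `w` has weight `1`. -/
def CEwt (m : ℕ) (b : CEMon m) : ℕ := b.2.card

/-- The differential on a monomial: apply `∂ w_{2(m+j)-1} = ∑_{a+b=m+j, 0 ≤ a,b ≤ m} v_{2a} v_{2b}`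
to each odd factor in turn, with the Koszul sign `(-1)^{#{l ∈ S | l < j}}` (writing the odd
factors in increasing order). -/
def CEdMon (m : ℕ) (b : CEMon m) : CEAlg m :=
  ∑ j ∈ b.2, ∑ a : Fin (m + 1),
    if h : j.val ≤ a.val then
      Finsupp.single
        (b.1 + Pi.single a 1 + Pi.single (⟨m + j.val - a.val, by omega⟩ : Fin (m + 1)) 1,
          b.2.erase j)
        ((-1 : ℚ) ^ (b.2.filter (fun l => l < j)).card)
    else 0

/-- The Chevalley–Eilenberg differential `∂`, as a linear map. -/
def CEd (m : ℕ) : CEAlg m →ₗ[ℚ] CEAlg m :=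
  Finsupp.lift (CEAlg m) ℚ (CEMon m) (CEdMon m)

/-- `Ω_k^{i,ω}(ℂP^m)`: the span of the monomials of length `k`, cohomological degree `i` and
weight `ω`. -/
def CEOmega (m k i ω : ℕ) : Submodule ℚ (CEAlg m) :=
  Finsupp.supported ℚ ℚ {b : CEMon m | CElen m b = k ∧ CEdeg m b = i ∧ CEwt m b = ω}

/-- A monomial is *bad* if it is divisible by `v_{2m}²` or by `w_{4m-1}`. -/
def CEBad (m : ℕ) (b : CEMon m) : Prop :=
  2 ≤ b.1 (Fin.last m) ∨ Fin.last m ∈ b.2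

open Classical in
/-- The projection of the Chevalley–Eilenberg algebra onto the span of the *good* monomials
(those not divisible by `v_{2m}²` nor by `w_{4m-1}`), annihilating the bad monomials.  The span
of the good monomials is canonically identified with the quotient of the algebra by the span of
the bad monomials. -/
def CEproj (m : ℕ) : CEAlg m →ₗ[ℚ] CEAlg m :=
  Finsupp.lift (CEAlg m) ℚ (CEMon m)
    (fun b => if CEBad m b then 0 else Finsupp.single b (1 : ℚ))

/-- The induced differential on the reduced complex `ʳΩ` (realized as the span of the good
monomials, canonically identified with the quotient by the span of the bad monomials). -/
def CErd (m : ℕ) : CEAlg m →ₗ[ℚ] CEAlg m := (CEproj m).comp (CEd m)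

/-- `ʳΩ_k^{i,ω}(ℂP^m)`: the reduced complex (the quotient of `Ω_k^{i,ω}(ℂP^m)` by the span of
the bad monomials, realized as the span of the good monomials of length `k`, degree `i` and
weight `ω`). -/
def CErOmega (m k i ω : ℕ) : Submodule ℚ (CEAlg m) :=
  Finsupp.supported ℚ ℚ
    {b : CEMon m | ¬ CEBad m b ∧ CElen m b = k ∧ CEdeg m b = i ∧ CEwt m b = ω}

/-- The degree-`i` part of the reduced complex `ʳΩ_k^{*,*}(ℂP^m)` (all weights together). -/
def CErOmegaDeg (m k i : ℕ) : Submodule ℚ (CEAlg m) :=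
  Finsupp.supported ℚ ℚ {b : CEMon m | ¬ CEBad m b ∧ CElen m b = k ∧ CEdeg m b = i}

/-- Cocycles of degree `i` in the reduced complex `ʳΩ_k^{*,*}(ℂP^m)`. -/
def CErCocycles (m k i : ℕ) : Submodule ℚ (CEAlg m) :=
  CErOmegaDeg m k i ⊓ LinearMap.ker (CErd m)

/-- The degree-`i` cohomology of the reduced complex `ʳΩ_k^{*,*}(ℂP^m)`:
cocycles of degree `i` modulo the image of the degree-`(i-1)` part under the differential. -/
abbrev CErCohomology (m k i : ℕ) : Type :=
  CErCocycles m k i ⧸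
    Submodule.comap (CErCocycles m k i).subtype
      (Submodule.map (CErd m) (CErOmegaDeg m k (i - 1)))

end

lemma CErd_single (m : ℕ) (b : CEMon m) (c : ℚ) :
    CErd m (Finsupp.single b c) = c • CEproj m (CEdMon m b) := by
  simp [CErd, CEd]

lemma CEproj_single_of_bad {m : ℕ} {b : CEMon m} (hb : CEBad m b) (c : ℚ) :
    CEproj m (Finsupp.single b c) = 0 := by
  simp [CEproj, hb]

lemma CEproj_single_of_not_bad {m : ℕ} {b : CEMon m} (hb : ¬ CEBad m b) (c : ℚ) :
    CEproj m (Finsupp.single b c) = Finsupp.single b c := by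
  simp [CEproj, hb]

/-- Projecting onto the good monomials only ever kills coefficients. -/
lemma CEproj_apply_eq_zero {m : ℕ} {x : CEAlg m} {b : CEMon m} (hx : x b = 0) :
    CEproj m x b = 0 := by
  classical
  simp only [CEproj, Finsupp.lift_apply, Finsupp.sum, Finsupp.finsetSum_apply]
  refine Finset.sum_eq_zero fun c _ => ?_
  by_cases hc : CEBad m c
  · simp [hc]
  · rcases eq_or_ne c b with rfl | hcb
    · simp [hx]
    · simp [hc, hcb]

/-- If `2 t < m`, no boundary involves a monomial whose only even generator is `v_{2t}`. -/
lemma CErd_apply_single_eq_zero {m : ℕ} (t : Fin (m + 1)) (ht : 2 * t.val < m) (n : ℕ)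
    (S : Finset (Fin (m + 1))) (γ : CEAlg m) :
    CErd m γ (Pi.single t n, S) = 0 := by
  classical
  refine CEproj_apply_eq_zero ?_
  simp only [CEd, Finsupp.lift_apply, Finsupp.sum, Finsupp.finsetSum_apply, Finsupp.smul_apply,
    CEdMon]
  refine Finset.sum_eq_zero fun b _ => smul_eq_zero_of_right _ <|
    Finset.sum_eq_zero fun j _ => Finset.sum_eq_zero fun p _ => ?_
  split_ifs with h
  · refine Finsupp.single_eq_of_ne fun heq => ?_
    have h1 := congrFun (congrArg Prod.fst heq)
    have hp : p = t := by
      by_contra hne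
      have := h1 p
      simp only [Pi.add_apply, Pi.single_eq_of_ne hne, Pi.single_eq_same] at this
      omega
    have hq : (⟨m + j.val - p.val, by omega⟩ : Fin (m + 1)) = t := by
      by_contra hne
      have := h1 ⟨m + j.val - p.val, by omega⟩
      simp only [Pi.add_apply, Pi.single_eq_of_ne hne, Pi.single_eq_same] at this
      omega
    have := congrArg Fin.val hq
    subst hp
    simp only at this
    omega
  · rfl

lemma CEdMon_singleton (m : ℕ) (e : Fin (m + 1) → ℕ) (j : Fin (m + 1)) :
    CEdMon m (e, {(⟨m - j.val, by omega⟩ : Fin (m + 1))}) =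
      ∑ y : Fin (m + 1), ∑ z : Fin (m + 1), if j.val + y.val + z.val = 2 * m then
        Finsupp.single (e + Pi.single y 1 + Pi.single z 1, ∅) 1 else 0 := by
  simp only [CEdMon, Finset.sum_singleton]
  refine Finset.sum_congr rfl fun y _ => ?_
  split_ifs with h
  · rw [Finset.sum_eq_single_of_mem (⟨m + (m - j.val) - y.val, by omega⟩ : Fin (m + 1))
      (Finset.mem_univ _)]
    · rw [if_pos (by simp only; omega)]
      simp [Finset.filter_singleton]
    · intro z _ hz
      rw [if_neg]
      rintro h'
      exact hz (Fin.ext (by simp only; omega))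
  · refine (Finset.sum_eq_zero fun z _ => if_neg ?_).symm
    omega

/-- A symmetric sum over triples with `x + y + z = 2m`, weighted by `2m - 3x`, vanishes. -/
lemma sum_symmetric_triples_eq_zero {M : Type*} [AddCommGroup M] [Module ℚ M] (m : ℕ)
    (G : Fin (m + 1) → Fin (m + 1) → Fin (m + 1) → M)
    (hxy : ∀ x y z, G x y z = G y x z) (hyz : ∀ x y z, G x y z = G x z y) :
    ∑ x : Fin (m + 1), ∑ y : Fin (m + 1), ∑ z : Fin (m + 1),
      (if x.val + y.val + z.val = 2 * m then ((2 * m : ℚ) - 3 * x.val) • G x y z else 0) = 0 := by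
  set S := ∑ x : Fin (m + 1), ∑ y : Fin (m + 1), ∑ z : Fin (m + 1),
      (if x.val + y.val + z.val = 2 * m then ((2 * m : ℚ) - 3 * x.val) • G x y z else 0) with hS
  have h1 : S = ∑ x : Fin (m + 1), ∑ y : Fin (m + 1), ∑ z : Fin (m + 1),
      (if x.val + y.val + z.val = 2 * m then ((2 * m : ℚ) - 3 * y.val) • G x y z else 0) := by
    rw [hS, Finset.sum_comm]
    refine Finset.sum_congr rfl fun x _ => Finset.sum_congr rfl fun y _ =>
      Finset.sum_congr rfl fun z _ => ?_
    rw [hxy y x z, add_comm y.val]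
  have h2 : S = ∑ x : Fin (m + 1), ∑ y : Fin (m + 1), ∑ z : Fin (m + 1),
      (if x.val + y.val + z.val = 2 * m then ((2 * m : ℚ) - 3 * z.val) • G x y z else 0) := by
    rw [h1]
    refine Finset.sum_congr rfl fun x _ => ?_
    rw [Finset.sum_comm]
    refine Finset.sum_congr rfl fun y _ => Finset.sum_congr rfl fun z _ => ?_
    rw [hyz x z y, add_right_comm]
  have h3 : S + S + S = 0 := by
    nth_rw 2 [h1]
    nth_rw 2 [h2]
    rw [hS]
    simp only [← Finset.sum_add_distrib]
    refine Finset.sum_eq_zero fun x _ => Finset.sum_eq_zero fun y _ =>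
      Finset.sum_eq_zero fun z _ => ?_
    split_ifs with h
    · rw [← add_smul, ← add_smul]
      have h' : (x.val : ℚ) + y.val + z.val = 2 * m := by exact_mod_cast h
      rw [show (2 * m : ℚ) - 3 * x.val + (2 * m - 3 * y.val) + (2 * m - 3 * z.val) = 0 by
        linarith, zero_smul]
    · simp
  have h4 : (3 : ℚ) • S = 0 := by
    rw [← h3]; module
  exact (smul_eq_zero.mp h4).resolve_left (by norm_num)

/-- The element `v_{2t}^n · α` with `α = ∑_{j=1}^{m} (2m - 3j) · v_{2j} · w_{4m-(2j+1)}`. -/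
noncomputable def CEbeta (m n : ℕ) (t : Fin (m + 1)) : CEAlg m :=
  ∑ j : Fin (m + 1), if j.val = 0 then 0 else
    Finsupp.single
      (((Pi.single t n + Pi.single j 1 : Fin (m + 1) → ℕ)),
        {(⟨m - j.val, by omega⟩ : Fin (m + 1))})
      ((2 * m : ℚ) - 3 * j.val)

lemma CErd_CEbeta (m n : ℕ) (t : Fin (m + 1)) : CErd m (CEbeta m n t) = 0 := by
  classical
  rw [← sum_symmetric_triples_eq_zero m (fun x y z => CEproj m (Finsupp.single
      ((Pi.single t n + Pi.single x 1 + Pi.single y 1 + Pi.single z 1 : Fin (m + 1) → ℕ), ∅) 1))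
    (fun x y z => by rw [add_right_comm (Pi.single t n : Fin (m + 1) → ℕ)])
    (fun x y z => by rw [add_right_comm _ (Pi.single y 1 : Fin (m + 1) → ℕ)]), CEbeta, map_sum]
  refine Finset.sum_congr rfl fun x _ => ?_
  split_ifs with hx
  · rw [map_zero]
    refine (Finset.sum_eq_zero fun y _ => Finset.sum_eq_zero fun z _ => ?_).symm
    split_ifs with h
    · have hy : y = Fin.last m := Fin.ext (by simp only [Fin.val_last]; omega)
      have hz : z = Fin.last m := Fin.ext (by simp only [Fin.val_last]; omega)
      rw [CEproj_single_of_bad, smul_zero]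
      left
      simp only [hy, hz, Pi.add_apply, Pi.single_eq_same]
      omega
    · rfl
  · rw [CErd_single, CEdMon_singleton, map_sum, Finset.smul_sum]
    refine Finset.sum_congr rfl fun y _ => ?_
    rw [map_sum, Finset.smul_sum]
    refine Finset.sum_congr rfl fun z _ => ?_
    split_ifs <;> simp

lemma CEbeta_apply (m n : ℕ) (t : Fin (m + 1)) (ht : t.val ≠ 0) :
    CEbeta m n t (Pi.single t (n + 1), {(⟨m - t.val, by omega⟩ : Fin (m + 1))}) =
      (2 * m : ℚ) - 3 * t.val := by
  classical
  rw [CEbeta, Finsupp.finsetSum_apply, Finset.sum_eq_single_of_mem t (Finset.mem_univ _)]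
  · rw [if_neg ht, ← Pi.single_add, Finsupp.single_eq_same]
  · intro j _ hj
    split_ifs with h
    · rfl
    · refine Finsupp.single_eq_of_ne fun heq => hj ?_
      have h2 := congrArg Prod.snd heq
      simp only [Finset.singleton_inj, Fin.mk.injEq] at h2
      exact Fin.ext (by omega)

lemma CEbeta_mem (m n : ℕ) (t : Fin (m + 1)) (ht : t.val < m) :
    CEbeta m n t ∈ CErOmega m (n + 3) (2 * t.val * n + 4 * m - 1) 1 := by
  classical
  refine Submodule.sum_mem _ fun j _ => ?_
  split_ifs with hj
  · exact Submodule.zero_mem _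
  · refine Finsupp.single_mem_supported ℚ _ ⟨?_, ?_, ?_, ?_⟩
    · have htl : Fin.last m ≠ t := fun h => by simp [← h] at ht
      rintro (h | h)
      · simp only [Pi.add_apply, Pi.single_eq_of_ne htl, Pi.single_apply] at h
        split_ifs at h <;> omega
      · simp only [Finset.mem_singleton, Fin.ext_iff, Fin.val_last] at h
        omega
    · simp [CElen, Finset.sum_add_distrib]
    · simp only [CEdeg, Pi.add_apply, mul_add, Finset.sum_add_distrib, Finset.sum_singleton,
        Pi.single_apply, mul_ite, mul_zero, Finset.sum_ite_eq', Finset.mem_univ, if_true]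
      omega
    · simp [CEwt]

lemma CErOmega_le_CErOmegaDeg (m k i ω : ℕ) : CErOmega m k i ω ≤ CErOmegaDeg m k i :=
  Finsupp.supported_mono fun _ h => ⟨h.1, h.2.1, h.2.2.1⟩

lemma CErd_ne_CEbeta (m n : ℕ) (t : Fin (m + 1)) (ht : t.val ≠ 0) (htm : 2 * t.val < m)
    (γ : CEAlg m) : CErd m γ ≠ CEbeta m n t := by
  intro h
  have h1 := CEbeta_apply m n t ht
  rw [← h, CErd_apply_single_eq_zero t htm] at h1
  have h2 : (2 * t.val : ℚ) < m := by exact_mod_cast htm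
  have h3 : (0 : ℚ) ≤ t.val := Nat.cast_nonneg _
  linarith

/-- For every `m ≥ 4`, `k ≥ 5` and even `a` with `2 ≤ a ≤ 2⌈m/2⌉ - 2`, the
element `β_{a,k} = v_a^{k-3} · α`, where `α = ∑_{j=1}^{m} (2m - 3j) · v_{2j} · w_{4m-(2j+1)}`,
is a cocycle of cohomological degree `a(k-3) + 4m - 1` in `ʳΩ_k^{*,*}(ℂP^m)` that is not a
coboundary; hence the cohomology of `ʳΩ_k^{*,*}(ℂP^m)` in degree `a(k-3) + 4m - 1` is
nonzero.  (The monomial `v_a^{k-3} v_{2j} w_{4m-2j-1}` is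
`(Pi.single (a/2) (k-3) + Pi.single j 1, {m - j})`.) -/
theorem beta_is_not_coboundary (m k a : ℕ) (hm : 4 ≤ m) (hk : 5 ≤ k) (ha : Even a)
    (ha2 : 2 ≤ a) (ha3 : a ≤ 2 * ((m + 1) / 2) - 2) :
    (∑ j : Fin (m + 1), if j.val = 0 then 0 else
        Finsupp.single
          (((Pi.single (⟨a / 2, by omega⟩ : Fin (m + 1)) (k - 3) + Pi.single j 1 :
              Fin (m + 1) → ℕ)), {(⟨m - j.val, by omega⟩ : Fin (m + 1))})
          ((2 * m : ℚ) - 3 * j.val))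
      ∈ CErOmega m k (a * (k - 3) + 4 * m - 1) 1 ∧
    CErd m
      (∑ j : Fin (m + 1), if j.val = 0 then 0 else
        Finsupp.single
          (((Pi.single (⟨a / 2, by omega⟩ : Fin (m + 1)) (k - 3) + Pi.single j 1 :
              Fin (m + 1) → ℕ)), {(⟨m - j.val, by omega⟩ : Fin (m + 1))})
          ((2 * m : ℚ) - 3 * j.val)) = 0 ∧
    (∀ γ ∈ CErOmegaDeg m k (a * (k - 3) + 4 * m - 2),
      CErd m γ ≠
        (∑ j : Fin (m + 1), if j.val = 0 then 0 else
          Finsupp.single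
            (((Pi.single (⟨a / 2, by omega⟩ : Fin (m + 1)) (k - 3) + Pi.single j 1 :
                Fin (m + 1) → ℕ)), {(⟨m - j.val, by omega⟩ : Fin (m + 1))})
            ((2 * m : ℚ) - 3 * j.val))) ∧
    Nontrivial (CErCohomology m k (a * (k - 3) + 4 * m - 1)) := by
  obtain ⟨n, rfl⟩ : ∃ n, k = n + 3 := ⟨k - 3, by omega⟩
  obtain ⟨t, rfl⟩ := ha.two_dvd
  have hlt : 2 * t / 2 < m + 1 := by omega
  change CEbeta m (n + 3 - 3) ⟨2 * t / 2, hlt⟩ ∈ _ ∧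
    CErd m (CEbeta m (n + 3 - 3) ⟨2 * t / 2, hlt⟩) = 0 ∧
    (∀ γ ∈ _, CErd m γ ≠ CEbeta m (n + 3 - 3) ⟨2 * t / 2, hlt⟩) ∧ _
  have hmem := CEbeta_mem m (n + 3 - 3) ⟨2 * t / 2, hlt⟩ (by simp only; omega)
  have hne := CErd_ne_CEbeta m (n + 3 - 3) ⟨2 * t / 2, hlt⟩ (by simp only; omega)
    (by simp only; omega)
  have hd := CErd_CEbeta m (n + 3 - 3) ⟨2 * t / 2, hlt⟩
  simp only [Nat.mul_div_cancel_left t two_pos, Nat.add_sub_cancel] at hmem hne hd ⊢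
  refine ⟨hmem, hd, fun γ _ => hne γ, ?_⟩
  let β : CErCocycles m (n + 3) (2 * t * n + 4 * m - 1) :=
    ⟨CEbeta m n ⟨t, by omega⟩, CErOmega_le_CErOmegaDeg _ _ _ _ hmem, hd⟩
  refine Submodule.Quotient.nontrivial_iff.mpr fun htop => ?_
  have hβ : β ∈ Submodule.comap (CErCocycles m (n + 3) (2 * t * n + 4 * m - 1)).subtype
      (Submodule.map (CErd m) (CErOmegaDeg m (n + 3) (2 * t * n + 4 * m - 1 - 1))) :=
    htop ▸ Submodule.mem_top
  obtain ⟨γ, -, hγ⟩ := hβ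
  exact hne γ hγ
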